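/- Let T be a tree with diameter 6 consisting of a root vertex v_0 adjacent to p ≥ 0 leaves, to r_1 ≥ 0 vertices v_1, …, v_{r_1} each of which is additionally adjacent to s_i ≥ 1 leaves, and to r_2 ≥ 2 vertices w'_1, …, w'_{r_2}, where the only other neighbor of w'_j is a vertex w_j that is additionally adjacent to t_j ≥ 1 leaves. Let r = r_1 + r_2 and let σ be the number of Laplacian eigenvalues of T strictly larger than the average degree d̄ = 2 − 2/n, where n is the number of vertices of T. Then r + 1 ≤ σ ≤ r + 4. -/

import Mathlib

open Polynomial

namespace LapPaper

variable {V : Type} [Fintype V] [DecidableEq V]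

/-- The multiset of Laplacian eigenvalues of `G` (with multiplicity), given as the
real roots of the characteristic polynomial of the Laplacian matrix `L = D - A`. -/
noncomputable def lapSpectrum (G : SimpleGraph V) [DecidableRel G.Adj] : Multiset ℝ :=
  (G.lapMatrix ℝ).charpoly.roots

/-- The average degree `d̄ = 2|E|/n` of a graph. -/
noncomputable def avgDeg (G : SimpleGraph V) [DecidableRel G.Adj] : ℝ :=
  2 * G.edgeFinset.card / Fintype.card V

/-- The Laplacian energy `LE(G) = ∑_i |μ_i - d̄|`. -/
noncomputable def LE (G : SimpleGraph V) [DecidableRel G.Adj] : ℝ :=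
  ((lapSpectrum G).map (fun x => |x - avgDeg G|)).sum

/-- `Sk G k` is the sum of the `k` largest Laplacian eigenvalues `μ_1 + ⋯ + μ_k` of `G`. -/
noncomputable def Sk (G : SimpleGraph V) [DecidableRel G.Adj] (k : ℕ) : ℝ :=
  ((((lapSpectrum G).sort (· ≤ ·)).reverse).take k).sum

/-- The number `σ` of Laplacian eigenvalues of `G` strictly larger than the average degree. -/
noncomputable def sigma (G : SimpleGraph V) [DecidableRel G.Adj] : ℕ :=
  Multiset.card ((lapSpectrum G).filter (fun x => avgDeg G < x))

/-- The double star `T(a,b)` on `a + b + 2` vertices: vertex `0` is adjacent to vertex `1`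
and to the `a` leaves `2, …, a+1`; vertex `1` is adjacent to the `b` leaves `a+2, …, a+b+1`. -/
def doubleStar (a b : ℕ) : SimpleGraph (Fin (a + b + 2)) :=
  SimpleGraph.fromRel (fun u v =>
    (u.1 = 0 ∧ v.1 = 1) ∨ (u.1 = 0 ∧ 2 ≤ v.1 ∧ v.1 < a + 2) ∨ (u.1 = 1 ∧ a + 2 ≤ v.1))

noncomputable instance (a b : ℕ) : DecidableRel (doubleStar a b).Adj := Classical.decRel _

/-- The star on `n` vertices: vertex `0` is adjacent to all other vertices. -/
def starGraph (n : ℕ) : SimpleGraph (Fin n) :=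
  SimpleGraph.fromRel (fun u _ => u.1 = 0)

noncomputable instance (n : ℕ) : DecidableRel (starGraph n).Adj := Classical.decRel _

end LapPaper

namespace LapPaper

/-- The diameter-6 tree with a root `Sum.inl ()` adjacent to `p` pendant leaves, to `r₁`
vertices `v_i` each additionally adjacent to `s i` leaves, and to `r₂` vertices `w'_j`,
where the only other neighbour `w_j` of `w'_j` is additionally adjacent to `t j` leaves.
In the `j`-th type-2 branch, `Sum.inl ()` is `w'_j`, `Sum.inr (Sum.inl ())` is `w_j`,
and `Sum.inr (Sum.inr l)` are the leaves of `w_j`. -/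
def diam6Tree (p r₁ r₂ : ℕ) (s : Fin r₁ → ℕ) (t : Fin r₂ → ℕ) :
    SimpleGraph (Unit ⊕ (Fin p ⊕ ((Σ i : Fin r₁, Unit ⊕ Fin (s i)) ⊕
      (Σ j : Fin r₂, Unit ⊕ (Unit ⊕ Fin (t j)))))) :=
  SimpleGraph.fromRel (fun u v =>
    (∃ j : Fin p, u = Sum.inl () ∧ v = Sum.inr (Sum.inl j)) ∨
    (∃ i : Fin r₁, u = Sum.inl () ∧ v = Sum.inr (Sum.inr (Sum.inl ⟨i, Sum.inl ()⟩))) ∨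
    (∃ (i : Fin r₁) (l : Fin (s i)), u = Sum.inr (Sum.inr (Sum.inl ⟨i, Sum.inl ()⟩)) ∧
      v = Sum.inr (Sum.inr (Sum.inl ⟨i, Sum.inr l⟩))) ∨
    (∃ j : Fin r₂, u = Sum.inl () ∧ v = Sum.inr (Sum.inr (Sum.inr ⟨j, Sum.inl ()⟩))) ∨
    (∃ j : Fin r₂, u = Sum.inr (Sum.inr (Sum.inr ⟨j, Sum.inl ()⟩)) ∧
      v = Sum.inr (Sum.inr (Sum.inr ⟨j, Sum.inr (Sum.inl ())⟩))) ∨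
    (∃ (j : Fin r₂) (l : Fin (t j)), u = Sum.inr (Sum.inr (Sum.inr ⟨j, Sum.inr (Sum.inl ())⟩)) ∧
      v = Sum.inr (Sum.inr (Sum.inr ⟨j, Sum.inr (Sum.inr l)⟩))))

noncomputable instance (p r₁ r₂ : ℕ) (s : Fin r₁ → ℕ) (t : Fin r₂ → ℕ) :
    DecidableRel (diam6Tree p r₁ r₂ s t).Adj :=
  Classical.decRel _

theorem dotProduct_mulVec_eq_sum_eigenvalues {V : Type*} [Fintype V] [DecidableEq V]
    {A : Matrix V V ℝ} (hA : A.IsHermitian) (c : ℝ) (x : V → ℝ) :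
    x ⬝ᵥ A.mulVec x - c * (x ⬝ᵥ x) =
      ∑ i, (hA.eigenvalues i - c) * (WithLp.ofLp (hA.eigenvectorBasis i) ⬝ᵥ x) ^ 2 := by
  set u : V → ℝ := fun i => WithLp.ofLp (hA.eigenvectorBasis i) ⬝ᵥ x with hu
  have expand (y : V → ℝ) : x ⬝ᵥ y =
      ∑ i, u i * (WithLp.ofLp (hA.eigenvectorBasis i) ⬝ᵥ y) := by
    have := hA.eigenvectorBasis.sum_inner_mul_inner (WithLp.toLp 2 x) (WithLp.toLp 2 y)
    simp only [EuclideanSpace.inner_eq_star_dotProduct, star_trivial] at this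
    rw [dotProduct_comm, ← this]
    exact Finset.sum_congr rfl fun i _ => by rw [hu, dotProduct_comm y]
  have hmul (i : V) : WithLp.ofLp (hA.eigenvectorBasis i) ⬝ᵥ A.mulVec x =
      hA.eigenvalues i * u i := by
    have hT : A.transpose = A := by simpa [Matrix.IsHermitian] using hA
    rw [Matrix.dotProduct_mulVec, ← Matrix.mulVec_transpose, hT, hA.mulVec_eigenvectorBasis,
      smul_dotProduct, smul_eq_mul]
  rw [expand, expand x, Finset.mul_sum, ← Finset.sum_sub_distrib]
  refine Finset.sum_congr rfl fun i _ => ?_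
  rw [hmul]
  ring

theorem card_filter_roots_charpoly {V : Type*} [Fintype V] [DecidableEq V]
    {A : Matrix V V ℝ} (hA : A.IsHermitian) (c : ℝ) :
    Multiset.card (A.charpoly.roots.filter (fun x => c < x)) =
      Fintype.card {i // c < hA.eigenvalues i} := by
  rw [hA.roots_charpoly_eq_eigenvalues, Multiset.filter_map, Multiset.card_map,
    Fintype.card_subtype]
  rfl

/-- If the quadratic form of `A - c` is nonpositive on the kernel of a linear map to `ℝ^ι`, then
`A` has at most `|ι|` eigenvalues larger than `c`. -/
theorem card_filter_roots_charpoly_le {V ι : Type*} [Fintype V] [DecidableEq V] [Fintype ι]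
    {A : Matrix V V ℝ} (hA : A.IsHermitian) (c : ℝ) (f : (V → ℝ) →ₗ[ℝ] (ι → ℝ))
    (hf : ∀ x, f x = 0 → x ⬝ᵥ A.mulVec x - c * (x ⬝ᵥ x) ≤ 0) :
    Multiset.card (A.charpoly.roots.filter (fun x => c < x)) ≤ Fintype.card ι := by
  rw [card_filter_roots_charpoly hA]
  let g : ({i // c < hA.eigenvalues i} → ℝ) →ₗ[ℝ] (V → ℝ) :=
    Fintype.linearCombination ℝ fun i => WithLp.ofLp (hA.eigenvectorBasis i.1)
  have orth (i j : V) : WithLp.ofLp (hA.eigenvectorBasis i) ⬝ᵥ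
      WithLp.ofLp (hA.eigenvectorBasis j) = if i = j then 1 else 0 := by
    have := orthonormal_iff_ite.mp hA.eigenvectorBasis.orthonormal j i
    simp only [EuclideanSpace.inner_eq_star_dotProduct, star_trivial] at this
    rw [this]
    simp only [eq_comm]
  have hg (y) (i : V) : WithLp.ofLp (hA.eigenvectorBasis i) ⬝ᵥ g y =
      if h : c < hA.eigenvalues i then y ⟨i, h⟩ else 0 := by
    simp only [g, Fintype.linearCombination_apply, dotProduct_sum, dotProduct_smul, orth,
      smul_eq_mul, mul_ite, mul_one, mul_zero]
    split_ifs with h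
    · rw [Finset.sum_eq_single ⟨i, h⟩] <;> simp +contextual [Subtype.ext_iff, eq_comm]
    · exact Finset.sum_eq_zero fun j _ => if_neg fun hij : i = j.1 => h (hij ▸ j.2)
  have hinj : Function.Injective (f ∘ₗ g) := by
    refine (injective_iff_map_eq_zero _).mpr fun y hy => ?_
    have h := hf _ hy
    rw [dotProduct_mulVec_eq_sum_eigenvalues hA] at h
    have hnn (i : V) : 0 ≤ (hA.eigenvalues i - c) *
        (WithLp.ofLp (hA.eigenvectorBasis i) ⬝ᵥ g y) ^ 2 := by
      rw [hg]
      split_ifs with hi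
      · exact mul_nonneg (sub_nonneg.mpr hi.le) (sq_nonneg _)
      · simp
    have h0 := (Finset.sum_eq_zero_iff_of_nonneg fun i _ => hnn i).mp
      (le_antisymm h (Finset.sum_nonneg fun i _ => hnn i))
    ext i
    have := h0 i.1 (Finset.mem_univ _)
    rw [hg, dif_pos i.2] at this
    simpa [(sub_pos.mpr i.2).ne'] using this
  simpa using LinearMap.finrank_le_finrank_of_injective hinj

/-- If the quadratic form of `A - c` is positive on the nonzero vectors of `ℝ^ι`, mapped linearly
to the domain of `A`, then `A` has at least `|ι|` eigenvalues larger than `c`. -/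
theorem le_card_filter_roots_charpoly {V ι : Type*} [Fintype V] [DecidableEq V] [Fintype ι]
    {A : Matrix V V ℝ} (hA : A.IsHermitian) (c : ℝ) (g : (ι → ℝ) →ₗ[ℝ] (V → ℝ))
    (hg : ∀ y, y ≠ 0 → 0 < g y ⬝ᵥ A.mulVec (g y) - c * (g y ⬝ᵥ g y)) :
    Fintype.card ι ≤ Multiset.card (A.charpoly.roots.filter (fun x => c < x)) := by
  rw [card_filter_roots_charpoly hA]
  let f : (V → ℝ) →ₗ[ℝ] ({i // c < hA.eigenvalues i} → ℝ) :=
    LinearMap.pi fun i => dotProductBilin ℝ ℝ (WithLp.ofLp (hA.eigenvectorBasis i.1))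
  have hinj : Function.Injective (f ∘ₗ g) := by
    refine (injective_iff_map_eq_zero _).mpr fun y hy => ?_
    by_contra hne
    refine (hg y hne).not_ge ?_
    rw [dotProduct_mulVec_eq_sum_eigenvalues hA]
    refine Finset.sum_nonpos fun i _ => ?_
    by_cases hi : c < hA.eigenvalues i
    · have : WithLp.ofLp (hA.eigenvectorBasis i) ⬝ᵥ g y = 0 := congrFun hy ⟨i, hi⟩
      simp [this]
    · exact mul_nonpos_of_nonpos_of_nonneg (by linarith) (sq_nonneg _)
  simpa using LinearMap.finrank_le_finrank_of_injective hinj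

/-- The Laplacian form of the graph of an asymmetric relation sums over the related pairs. -/
theorem dotProduct_lapMatrix_fromRel {V : Type*} [Fintype V] [DecidableEq V] {G : SimpleGraph V}
    [DecidableRel G.Adj] {r : V → V → Prop} [DecidableRel r] (hG : G = SimpleGraph.fromRel r)
    (hr : ∀ u v, r u v → ¬ r v u) (x : V → ℝ) :
    x ⬝ᵥ ((G.lapMatrix ℝ).mulVec x) =
      ∑ u, ∑ v, if r u v then (x u - x v) ^ 2 else 0 := by
  have h (u v : V) : (if G.Adj u v then (x u - x v) ^ 2 else 0) =
      (if r u v then (x u - x v) ^ 2 else 0) + if r v u then (x v - x u) ^ 2 else 0 := by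
    have huv : u = v → ¬ r u v := by rintro rfl h; exact hr _ _ h h
    have hvu : u = v → ¬ r v u := by rintro rfl h; exact hr _ _ h h
    have := hr u v
    rw [sub_sq_comm (x v)]
    by_cases h1 : r u v <;> by_cases h2 : r v u <;> simp_all [SimpleGraph.fromRel_adj]
  rw [← Matrix.toLinearMap₂'_apply', SimpleGraph.lapMatrix_toLinearMap₂']
  simp only [h, Finset.sum_add_distrib]
  rw [Finset.sum_comm (f := fun u v => if r v u then (x v - x u) ^ 2 else 0)]
  ring

/-- The Laplacian form of a graph is the sum over an injective enumeration of its oriented edges. -/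
theorem dotProduct_lapMatrix_eq_sum {V κ : Type*} [Fintype V] [DecidableEq V] [Fintype κ]
    {G : SimpleGraph V} [DecidableRel G.Adj] {r : V → V → Prop} (hG : G = SimpleGraph.fromRel r)
    (hr : ∀ u v, r u v → ¬ r v u) (e : κ → V × V) (he : Function.Injective e)
    (hre : ∀ u v, r u v ↔ ∃ k, (u, v) = e k) (x : V → ℝ) :
    x ⬝ᵥ ((G.lapMatrix ℝ).mulVec x) = ∑ k, (x (e k).1 - x (e k).2) ^ 2 := by
  classical
  rw [dotProduct_lapMatrix_fromRel hG hr, ← Fintype.sum_prod_type'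
    (f := fun u v => if r u v then (x u - x v) ^ 2 else 0), ← Finset.sum_filter]
  have : Finset.univ.filter (fun q : V × V => r q.1 q.2) = Finset.univ.map ⟨e, he⟩ := by
    ext ⟨u, v⟩
    simp [hre, eq_comm]
  rw [this, Finset.sum_map]
  rfl

/-- The Laplacian quadratic form of `diam6Tree`, edge by edge. -/
theorem dotProduct_lapMatrix_diam6Tree (p r₁ r₂ : ℕ) (s : Fin r₁ → ℕ) (t : Fin r₂ → ℕ)
    (x : Unit ⊕ (Fin p ⊕ ((Σ i : Fin r₁, Unit ⊕ Fin (s i)) ⊕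
      (Σ j : Fin r₂, Unit ⊕ (Unit ⊕ Fin (t j))))) → ℝ) :
    x ⬝ᵥ (((diam6Tree p r₁ r₂ s t).lapMatrix ℝ).mulVec x) =
      ∑ k, (x (.inl ()) - x (.inr (.inl k))) ^ 2 +
      ∑ i, ((x (.inl ()) - x (.inr (.inr (.inl ⟨i, .inl ()⟩)))) ^ 2 +
        ∑ l, (x (.inr (.inr (.inl ⟨i, .inl ()⟩))) - x (.inr (.inr (.inl ⟨i, .inr l⟩)))) ^ 2) +
      ∑ j, ((x (.inl ()) - x (.inr (.inr (.inr ⟨j, .inl ()⟩)))) ^ 2 +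
        (x (.inr (.inr (.inr ⟨j, .inl ()⟩))) -
          x (.inr (.inr (.inr ⟨j, .inr (.inl ())⟩)))) ^ 2 +
        ∑ l, (x (.inr (.inr (.inr ⟨j, .inr (.inl ())⟩))) -
          x (.inr (.inr (.inr ⟨j, .inr (.inr l)⟩)))) ^ 2) := by
  refine (dotProduct_lapMatrix_eq_sum (G := diam6Tree p r₁ r₂ s t) rfl ?_ (Sum.elim
    (fun k : Fin p => (.inl (), .inr (.inl k))) <| Sum.elim
    (fun i : Fin r₁ => (.inl (), .inr (.inr (.inl ⟨i, .inl ()⟩)))) <| Sum.elim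
    (fun k : Σ i : Fin r₁, Fin (s i) =>
      (.inr (.inr (.inl ⟨k.1, .inl ()⟩)), .inr (.inr (.inl ⟨k.1, .inr k.2⟩)))) <| Sum.elim
    (fun j : Fin r₂ => (.inl (), .inr (.inr (.inr ⟨j, .inl ()⟩)))) <| Sum.elim
    (fun j : Fin r₂ =>
      (.inr (.inr (.inr ⟨j, .inl ()⟩)), .inr (.inr (.inr ⟨j, .inr (.inl ())⟩))))
    (fun k : Σ j : Fin r₂, Fin (t j) => (.inr (.inr (.inr ⟨k.1, .inr (.inl ())⟩)),
      .inr (.inr (.inr ⟨k.1, .inr (.inr k.2)⟩)))))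
    ?_ ?_ x).trans ?_
  · rintro u v (⟨j, rfl, rfl⟩ | ⟨i, rfl, rfl⟩ | ⟨i, l, rfl, rfl⟩ | ⟨j, rfl, rfl⟩ | ⟨j, rfl, rfl⟩ |
      ⟨j, l, rfl, rfl⟩) <;> simp
  · rintro (a | a | ⟨a, a'⟩ | a | a | ⟨a, a'⟩) (b | b | ⟨b, b'⟩ | b | b | ⟨b, b'⟩) h <;>
      simp_all
    all_goals
      obtain ⟨⟨rfl, _⟩, h⟩ := h
      simp_all
  · intro u v
    simp only [Sum.exists, Sigma.exists, Sum.elim_inl, Sum.elim_inr, Prod.mk.injEq]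
  · simp only [Fintype.sum_sum_type, Fintype.sum_sigma, Sum.elim_inl, Sum.elim_inr,
      Finset.sum_add_distrib]
    ring

/-- The quadratic form of `L - c` on `diam6Tree`, branch by branch. -/
theorem shifted_form_diam6Tree (p r₁ r₂ : ℕ) (s : Fin r₁ → ℕ) (t : Fin r₂ → ℕ) (c : ℝ)
    (x : Unit ⊕ (Fin p ⊕ ((Σ i : Fin r₁, Unit ⊕ Fin (s i)) ⊕
      (Σ j : Fin r₂, Unit ⊕ (Unit ⊕ Fin (t j))))) → ℝ) :
    x ⬝ᵥ (((diam6Tree p r₁ r₂ s t).lapMatrix ℝ).mulVec x) - c * (x ⬝ᵥ x) =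
      -(c * x (.inl ()) ^ 2) +
      ∑ k, ((x (.inl ()) - x (.inr (.inl k))) ^ 2 - c * x (.inr (.inl k)) ^ 2) +
      ∑ i, ((x (.inl ()) - x (.inr (.inr (.inl ⟨i, .inl ()⟩)))) ^ 2 -
          c * x (.inr (.inr (.inl ⟨i, .inl ()⟩))) ^ 2 +
        ∑ l, ((x (.inr (.inr (.inl ⟨i, .inl ()⟩))) - x (.inr (.inr (.inl ⟨i, .inr l⟩)))) ^ 2 -
          c * x (.inr (.inr (.inl ⟨i, .inr l⟩))) ^ 2)) +
      ∑ j, ((x (.inl ()) - x (.inr (.inr (.inr ⟨j, .inl ()⟩)))) ^ 2 -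
          c * x (.inr (.inr (.inr ⟨j, .inl ()⟩))) ^ 2 +
        ((x (.inr (.inr (.inr ⟨j, .inl ()⟩))) -
          x (.inr (.inr (.inr ⟨j, .inr (.inl ())⟩)))) ^ 2 -
          c * x (.inr (.inr (.inr ⟨j, .inr (.inl ())⟩))) ^ 2) +
        ∑ l, ((x (.inr (.inr (.inr ⟨j, .inr (.inl ())⟩))) -
          x (.inr (.inr (.inr ⟨j, .inr (.inr l)⟩)))) ^ 2 -
          c * x (.inr (.inr (.inr ⟨j, .inr (.inr l)⟩))) ^ 2)) := by
  rw [dotProduct_lapMatrix_diam6Tree]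
  simp only [dotProduct, Fintype.sum_sum_type, Fintype.sum_sigma, Finset.sum_add_distrib,
    Finset.sum_sub_distrib, ← Finset.mul_sum, Finset.univ_unique, Finset.sum_singleton,
    PUnit.default_eq_unit, ← sq]
  ring

theorem le_card_filter_lapSpectrum_diam6Tree (p r₁ r₂ : ℕ) (hr₂ : 2 ≤ r₂)
    (s : Fin r₁ → ℕ) (hs : ∀ i, 1 ≤ s i) (t : Fin r₂ → ℕ) (ht : ∀ j, 1 ≤ t j)
    (c : ℝ) (hc : c < 2) :
    r₁ + r₂ + 1 ≤ Multiset.card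
      ((lapSpectrum (diam6Tree p r₁ r₂ s t)).filter (fun x => c < x)) := by
  let g : ((Fin r₁ ⊕ Fin r₂) ⊕ Unit → ℝ) →ₗ[ℝ]
      (Unit ⊕ (Fin p ⊕ ((Σ i : Fin r₁, Unit ⊕ Fin (s i)) ⊕
      (Σ j : Fin r₂, Unit ⊕ (Unit ⊕ Fin (t j))))) → ℝ) :=
    LinearMap.pi <| Sum.elim (fun _ => LinearMap.proj (.inr ())) <| Sum.elim (fun _ => 0) <|
      Sum.elim (fun k => Sum.elim (fun _ => LinearMap.proj (.inl (.inl k.1)))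
        (fun _ => -LinearMap.proj (.inl (.inl k.1))) k.2)
      (fun k => Sum.elim (fun _ => 0) (Sum.elim (fun _ => LinearMap.proj (.inl (.inr k.1)))
        (fun _ => -LinearMap.proj (.inl (.inr k.1)))) k.2)
  have key := le_card_filter_roots_charpoly
    (SimpleGraph.isHermitian_lapMatrix (R := ℝ) (diam6Tree p r₁ r₂ s t)) c g ?_
  · simpa [lapSpectrum] using key
  intro y hy
  rw [shifted_form_diam6Tree]
  simp only [g, LinearMap.pi_apply, Sum.elim_inl, Sum.elim_inr, LinearMap.proj_apply,
    LinearMap.zero_apply, LinearMap.neg_apply, Finset.sum_const, Finset.card_univ,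
    Fintype.card_fin, nsmul_eq_mul]
  generalize hz : y (.inr ()) = z
  have h₁ : ∑ i, (4 - 2 * c) * y (.inl (.inl i)) ^ 2 ≤ ∑ i, ((z - y (.inl (.inl i))) ^ 2 -
      c * y (.inl (.inl i)) ^ 2 + s i * ((y (.inl (.inl i)) - -y (.inl (.inl i))) ^ 2 -
        c * (-y (.inl (.inl i))) ^ 2)) := by
    refine Finset.sum_le_sum fun i _ => ?_
    have : (1 : ℝ) ≤ s i := by exact_mod_cast hs i
    nlinarith [sq_nonneg (z - y (.inl (.inl i))), mul_nonneg (mul_nonneg (sub_nonneg.mpr this)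
      (by linarith : 0 ≤ 4 - c)) (sq_nonneg (y (.inl (.inl i))))]
  have h₂ : ∑ j, (z ^ 2 + (4 - 2 * c) * y (.inl (.inr j)) ^ 2) ≤ ∑ j, ((z - 0) ^ 2 - c * 0 ^ 2 +
      ((0 - y (.inl (.inr j))) ^ 2 - c * y (.inl (.inr j)) ^ 2) +
      t j * ((y (.inl (.inr j)) - -y (.inl (.inr j))) ^ 2 - c * (-y (.inl (.inr j))) ^ 2)) := by
    refine Finset.sum_le_sum fun j _ => ?_
    have : (1 : ℝ) ≤ t j := by exact_mod_cast ht j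
    nlinarith [sq_nonneg (y (.inl (.inr j))), mul_nonneg (mul_nonneg (sub_nonneg.mpr this)
      (by linarith : 0 ≤ 4 - c)) (sq_nonneg (y (.inl (.inr j))))]
  rw [Finset.sum_add_distrib, Finset.sum_const, Finset.card_univ, Fintype.card_fin,
    nsmul_eq_mul] at h₂
  have hr : (2 : ℝ) ≤ r₂ := by exact_mod_cast hr₂
  have hz2 := mul_le_mul_of_nonneg_right hr (sq_nonneg z)
  have hp : 0 ≤ (p : ℝ) * z ^ 2 := by positivity
  have hpos : 0 < (2 - c) * ∑ k, y k ^ 2 := by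
    refine mul_pos (by linarith) ?_
    obtain ⟨k, hk⟩ := Function.ne_iff.mp hy
    exact Finset.sum_pos' (fun k _ => sq_nonneg _) ⟨k, Finset.mem_univ _, sq_pos_of_ne_zero hk⟩
  simp only [Fintype.sum_sum_type, Finset.univ_unique, Finset.sum_singleton,
    PUnit.default_eq_unit, hz] at hpos
  have hn₁ : 0 ≤ (2 - c) * ∑ i, y (.inl (.inl i)) ^ 2 :=
    mul_nonneg (by linarith) (Finset.sum_nonneg fun _ _ => sq_nonneg _)
  have hn₂ : 0 ≤ (2 - c) * ∑ j, y (.inl (.inr j)) ^ 2 :=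
    mul_nonneg (by linarith) (Finset.sum_nonneg fun _ _ => sq_nonneg _)
  rw [← Finset.mul_sum] at h₁ h₂
  linarith

/-- Eliminating the leaves of a vertex from the quadratic form of `L - c`. -/
theorem sum_leaf_form_le {m : ℕ} {c : ℝ} (hc : 1 < c) (d : ℝ) (e : Fin m → ℝ) :
    ∑ l, ((d - e l) ^ 2 - c * e l ^ 2) ≤ (m + m / (c - 1)) * d ^ 2 := by
  have h (l : Fin m) : (d - e l) ^ 2 - c * e l ^ 2 ≤ d ^ 2 + d ^ 2 / (c - 1) := by
    have hc' : 0 < c - 1 := by linarith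
    have : d ^ 2 + d ^ 2 / (c - 1) - ((d - e l) ^ 2 - c * e l ^ 2) =
        (d + (c - 1) * e l) ^ 2 / (c - 1) := by
      field_simp
      ring
    have : 0 ≤ (d + (c - 1) * e l) ^ 2 / (c - 1) := by positivity
    linarith
  calc _ ≤ ∑ _l : Fin m, (d ^ 2 + d ^ 2 / (c - 1)) := Finset.sum_le_sum fun l _ => h l
    _ = _ := by
      rw [Finset.sum_const, Finset.card_univ, Fintype.card_fin, nsmul_eq_mul]
      ring

/-- The coefficient of the square of a vertex with one nonleaf neighbour and `m` leaves, after
eliminating the leaves from the quadratic form of `L - c`. -/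
noncomputable def elimCoeff (c : ℝ) (m : ℕ) : ℝ := m + 1 - c + m / (c - 1)

theorem elimCoeff_pos {c : ℝ} (hc₁ : 1 < c) (hc₂ : c < 2) {m : ℕ} (hm : 1 ≤ m) :
    0 < elimCoeff c m := by
  have : (1 : ℝ) ≤ m := by exact_mod_cast hm
  have : 0 < m / (c - 1) := div_pos (by linarith) (by linarith)
  unfold elimCoeff
  linarith

theorem card_filter_lapSpectrum_diam6Tree_le (p r₁ r₂ : ℕ)
    (s : Fin r₁ → ℕ) (t : Fin r₂ → ℕ) (ht : ∀ j, 1 ≤ t j)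
    (c : ℝ) (hc₁ : 1 < c) (hc₂ : c < 2) :
    Multiset.card ((lapSpectrum (diam6Tree p r₁ r₂ s t)).filter (fun x => c < x)) ≤
      r₁ + r₂ + 1 + Fintype.card {j // 1 < (2 - c) * elimCoeff c (t j)} := by
  let f : (Unit ⊕ (Fin p ⊕ ((Σ i : Fin r₁, Unit ⊕ Fin (s i)) ⊕
      (Σ j : Fin r₂, Unit ⊕ (Unit ⊕ Fin (t j))))) → ℝ) →ₗ[ℝ]
      (((Fin r₁ ⊕ Fin r₂) ⊕ Unit) ⊕ {j // 1 < (2 - c) * elimCoeff c (t j)} → ℝ) :=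
    LinearMap.pi <| Sum.elim (Sum.elim (Sum.elim
      (fun i => LinearMap.proj (.inr (.inr (.inl ⟨i, .inl ()⟩))))
      (fun j => elimCoeff c (t j) • LinearMap.proj (.inr (.inr (.inr ⟨j, .inr (.inl ())⟩))) -
        LinearMap.proj (.inr (.inr (.inr ⟨j, .inl ()⟩)))))
      (fun _ => LinearMap.proj (.inl ())))
      (fun j => LinearMap.proj (.inr (.inr (.inr ⟨j.1, .inl ()⟩))))
  have key := card_filter_roots_charpoly_le
    (SimpleGraph.isHermitian_lapMatrix (R := ℝ) (diam6Tree p r₁ r₂ s t)) c f ?_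
  · simpa [lapSpectrum] using key
  intro x hx
  have hv (i : Fin r₁) : x (.inr (.inr (.inl ⟨i, .inl ()⟩))) = 0 :=
    congrFun hx (.inl (.inl (.inl i)))
  have hw (j : Fin r₂) : elimCoeff c (t j) * x (.inr (.inr (.inr ⟨j, .inr (.inl ())⟩))) -
      x (.inr (.inr (.inr ⟨j, .inl ()⟩))) = 0 := congrFun hx (.inl (.inl (.inr j)))
  have hz : x (.inl ()) = 0 := congrFun hx (.inl (.inr ()))
  have hP (j : Fin r₂) (hj : 1 < (2 - c) * elimCoeff c (t j)) :
      x (.inr (.inr (.inr ⟨j, .inl ()⟩))) = 0 := congrFun hx (.inr ⟨j, hj⟩)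
  rw [shifted_form_diam6Tree, hz]
  simp only [hv]
  have h₀ := sum_leaf_form_le hc₁ 0 fun k => x (.inr (.inl k))
  have h₁ (i : Fin r₁) := sum_leaf_form_le hc₁ 0 fun l => x (.inr (.inr (.inl ⟨i, .inr l⟩)))
  have h₂ : ∑ i : Fin r₁, (((0 : ℝ) - 0) ^ 2 - c * 0 ^ 2 +
      ∑ l, ((0 - x (.inr (.inr (.inl ⟨i, .inr l⟩)))) ^ 2 -
        c * x (.inr (.inr (.inl ⟨i, .inr l⟩))) ^ 2)) ≤ 0 :=
    Finset.sum_nonpos fun i _ => by linarith [h₁ i]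
  refine add_nonpos (by linarith) (Finset.sum_nonpos fun j _ => ?_)
  have h₃ := sum_leaf_form_le hc₁ (x (.inr (.inr (.inr ⟨j, .inr (.inl ())⟩))))
    fun l => x (.inr (.inr (.inr ⟨j, .inr (.inr l)⟩)))
  have hα := elimCoeff_pos hc₁ hc₂ (ht j)
  have hαe : elimCoeff c (t j) = t j + 1 - c + t j / (c - 1) := rfl
  have hwj := hw j
  generalize x (.inr (.inr (.inr ⟨j, .inr (.inl ())⟩))) = d at *
  have hu : x (.inr (.inr (.inr ⟨j, .inl ()⟩))) = elimCoeff c (t j) * d := by linarith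
  have hd : elimCoeff c (t j) * d ^ 2 * ((2 - c) * elimCoeff c (t j) - 1) ≤ 0 := by
    by_cases hj : 1 < (2 - c) * elimCoeff c (t j)
    · have : d = 0 := by simpa [hα.ne', hP j hj] using hu.symm
      simp [this]
    · exact mul_nonpos_of_nonneg_of_nonpos (by positivity) (by linarith)
  rw [hu]
  have : (t j + t j / (c - 1)) * d ^ 2 = (elimCoeff c (t j) - 1 + c) * d ^ 2 := by
    rw [hαe]; ring
  linarith

/-- At most three type-2 branches contribute a second eigenvalue above the average degree. -/
theorem card_large_branches_le (r₂ n : ℕ) (hn : 3 ≤ n) (t : Fin r₂ → ℕ)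
    (hsum : 1 + ∑ j, (2 + t j) ≤ n) :
    Fintype.card {j // 1 < (2 - (2 - 2 / (n : ℝ))) * elimCoeff (2 - 2 / (n : ℝ)) (t j)} ≤ 3 := by
  classical
  rw [Fintype.card_subtype]
  set P := Finset.univ.filter
    fun j => 1 < (2 - (2 - 2 / (n : ℝ))) * elimCoeff (2 - 2 / (n : ℝ)) (t j) with hPdef
  by_contra! hP
  have hk : (4 : ℝ) ≤ P.card := by exact_mod_cast hP
  have hn' : (3 : ℝ) ≤ n := by exact_mod_cast hn
  have hsumP : 1 + (2 * (P.card : ℝ) + ∑ j ∈ P, (t j : ℝ)) ≤ n := by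
    have h : ∑ j ∈ P, (2 + t j) ≤ ∑ j, (2 + t j) :=
      Finset.sum_le_sum_of_subset (Finset.subset_univ P)
    rw [Finset.sum_add_distrib, Finset.sum_const, smul_eq_mul] at h
    have : 1 + (2 * P.card + ∑ j ∈ P, t j) ≤ n := by linarith
    exact_mod_cast this
  have hj (j) (hjP : j ∈ P) : (n : ℝ) * (n - 2) + 2 * (n - 2) ^ 2 / n ≤
      4 * (n - 1) * t j := by
    have h := (Finset.mem_filter.mp hjP).2
    have h2 : (0 : ℝ) < n - 2 := by linarith
    have h3 : 1 - 2 / (n : ℝ) ≠ 0 := by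
      rw [ne_eq, sub_eq_zero, eq_div_iff (by linarith)]
      linarith
    have e : (2 - (2 - 2 / (n : ℝ))) * elimCoeff (2 - 2 / (n : ℝ)) (t j) * (n * (n - 2)) =
        4 * (n - 1) * t j - 2 * (n - 2) ^ 2 / n := by
      unfold elimCoeff
      have : 2 - 2 / (n : ℝ) - 1 = (n - 2) / n := by field_simp; ring
      rw [this]
      field_simp
      ring
    have := mul_lt_mul_of_pos_right h (by positivity : 0 < (n : ℝ) * (n - 2))
    linarith
  have hs := Finset.sum_le_sum hj
  rw [Finset.sum_const, nsmul_eq_mul, ← Finset.mul_sum] at hs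
  have hq : 0 ≤ 2 * ((n : ℝ) - 2) ^ 2 / n := by positivity
  have h₁ := mul_le_mul_of_nonneg_right hk (add_nonneg
    (mul_nonneg (by linarith : (0 : ℝ) ≤ n) (by linarith : (0 : ℝ) ≤ n - 2)) hq)
  have h₂ := mul_le_mul_of_nonneg_left (by linarith : ∑ j ∈ P, (t j : ℝ) ≤ n - 9)
    (by linarith : (0 : ℝ) ≤ 4 * (n - 1))
  nlinarith

/-- Let `T` be the diameter-6 tree whose root is adjacent to `p ≥ 0` leaves,
to `r₁ ≥ 0` vertices `v_i` each additionally adjacent to `s_i ≥ 1` leaves, and to `r₂ ≥ 2`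
vertices `w'_j` whose only other neighbour `w_j` is additionally adjacent to `t_j ≥ 1`
leaves. Let `r = r₁ + r₂`, let `n` be the number of vertices of `T`, and let `σ` be the
number of Laplacian eigenvalues of `T` strictly larger than the average degree `2 - 2/n`.
Then `r + 1 ≤ σ ≤ r + 4`. -/
theorem sigma_diam6Tree (p r₁ r₂ : ℕ) (hr₂ : 2 ≤ r₂)
    (s : Fin r₁ → ℕ) (hs : ∀ i, 1 ≤ s i) (t : Fin r₂ → ℕ) (ht : ∀ j, 1 ≤ t j)
    (n : ℕ) (hn : n = Fintype.card (Unit ⊕ (Fin p ⊕ ((Σ i : Fin r₁, Unit ⊕ Fin (s i)) ⊕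
      (Σ j : Fin r₂, Unit ⊕ (Unit ⊕ Fin (t j)))))))
    (σ : ℕ)
    (hσ : σ = Multiset.card
      ((lapSpectrum (diam6Tree p r₁ r₂ s t)).filter (fun x => 2 - 2 / (n : ℝ) < x))) :
    r₁ + r₂ + 1 ≤ σ ∧ σ ≤ r₁ + r₂ + 4 := by
  have hcard : 1 + ∑ j, (2 + t j) ≤ n := by
    rw [hn]
    simp only [Fintype.card_sum, Fintype.card_sigma, Fintype.card_unit, Fintype.card_fin,
      ← add_assoc, Nat.reduceAdd]
    omega
  have hn3 : 3 ≤ n := by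
    have : ∑ _j : Fin r₂, 1 ≤ ∑ j, (2 + t j) := Finset.sum_le_sum fun j _ => by omega
    simp only [Finset.sum_const, Finset.card_univ, Fintype.card_fin, smul_eq_mul, mul_one] at this
    omega
  have hn' : (3 : ℝ) ≤ n := by exact_mod_cast hn3
  have hpos : 0 < 2 / (n : ℝ) := by positivity
  have hlt : 2 / (n : ℝ) < 1 := (div_lt_one (by linarith)).mpr (by linarith)
  subst hσ
  refine ⟨le_card_filter_lapSpectrum_diam6Tree p r₁ r₂ hr₂ s hs t ht _ (by linarith), ?_⟩
  have h := card_filter_lapSpectrum_diam6Tree_le p r₁ r₂ s t ht (2 - 2 / (n : ℝ))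
    (by linarith) (by linarith)
  have := card_large_branches_le r₂ n hn3 t hcard
  omega

end LapPaper
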